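/- Fix T > 0 and let Ω_T ⊂ [0,1) × ℝ consist of all (x,c) with x = 0, or x ∈ (0,1) and T·φ(x) + c > 0. Define C_T : Ω_T → [0,1) by C_T(0,c) = 0 and C_T(x,c) = φ⁻¹(T·φ(x) + c) for x > 0. Then C_T is smooth and ∂_x C_T(0,c) = 1 for all c ∈ ℝ. Moreover C_T(x,c) = B_T(B(x, c/T)) where B_T(x) = φ⁻¹(T·φ(x)) and B(x,c) = φ⁻¹(φ(x)+c). -/

import Mathlib

open Set

/-- The factor `h` with `φ⁻¹(T·φ(x) + c) = x · h(x, c)`, written so that it is smooth at `x = 0`. -/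
noncomputable def glueFactor (T : ℝ) (p : ℝ × ℝ) : ℝ :=
  (1 + p.1 * Real.log (T + (p.2 + Real.exp 1 - T * Real.exp 1) * expNegInvGlue p.1))⁻¹

lemma contDiffAt_glueFactor {T : ℝ} {p : ℝ × ℝ}
    (h₁ : 0 < T + (p.2 + Real.exp 1 - T * Real.exp 1) * expNegInvGlue p.1)
    (h₂ : 1 + p.1 * Real.log (T + (p.2 + Real.exp 1 - T * Real.exp 1) * expNegInvGlue p.1) ≠ 0) :
    ContDiffAt ℝ (⊤ : ℕ∞) (glueFactor T) p := by
  have hg : ContDiff ℝ (⊤ : ℕ∞) (fun q : ℝ × ℝ => expNegInvGlue q.1) :=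
    expNegInvGlue.contDiff.comp contDiff_fst
  have ha : ContDiff ℝ (⊤ : ℕ∞) (fun q : ℝ × ℝ =>
      T + (q.2 + Real.exp 1 - T * Real.exp 1) * expNegInvGlue q.1) :=
    contDiff_const.add
      (((contDiff_snd.add contDiff_const).sub contDiff_const).mul hg)
  exact (contDiffAt_const.add (contDiffAt_fst.mul (ha.contDiffAt.log h₁.ne'))).inv h₂

lemma glueFactor_zero (T c : ℝ) : glueFactor T (0, c) = 1 := by
  simp [glueFactor]

lemma contDiffAt_glueFactor_zero {T : ℝ} (hT : 0 < T) (c : ℝ) :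
    ContDiffAt ℝ (⊤ : ℕ∞) (glueFactor T) (0, c) :=
  contDiffAt_glueFactor (by simpa using hT) (by simp)

lemma add_mul_expNegInvGlue_eq (T c : ℝ) {x : ℝ} (hx : 0 < x) :
    T + (c + Real.exp 1 - T * Real.exp 1) * expNegInvGlue x =
      Real.exp (-(1 / x)) * (T * (Real.exp (1 / x) - Real.exp 1) + c + Real.exp 1) := by
  have h : Real.exp (-(1 / x)) * Real.exp (1 / x) = 1 := by
    rw [← Real.exp_add]; simp
  rw [expNegInvGlue, if_neg hx.not_ge, ← one_div]
  linear_combination (-T) * h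

lemma one_add_mul_log_eq {T c x : ℝ} (hx : 0 < x)
    (h : T * (Real.exp (1 / x) - Real.exp 1) + c + Real.exp 1 ≠ 0) :
    1 + x * Real.log (T + (c + Real.exp 1 - T * Real.exp 1) * expNegInvGlue x) =
      x * Real.log (T * (Real.exp (1 / x) - Real.exp 1) + c + Real.exp 1) := by
  rw [add_mul_expNegInvGlue_eq T c hx, Real.log_mul (Real.exp_pos _).ne' h, Real.log_exp]
  field_simp
  ring

lemma one_div_log_eq_mul_glueFactor {T c x : ℝ} (hx : 0 < x)
    (h : T * (Real.exp (1 / x) - Real.exp 1) + c + Real.exp 1 ≠ 0) :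
    1 / Real.log (T * (Real.exp (1 / x) - Real.exp 1) + c + Real.exp 1) =
      x * glueFactor T (x, c) := by
  rw [glueFactor, one_add_mul_log_eq hx h, mul_inv, mul_inv_cancel_left₀ hx.ne', one_div]

lemma log_add_exp_one_pos {y : ℝ} (hy : 0 < y) : 0 < Real.log (y + Real.exp 1) :=
  Real.log_pos (by linarith [Real.add_one_lt_exp (one_ne_zero (α := ℝ))])

lemma eventually_add_exp_one_ne_zero {T : ℝ} (hT : 0 < T) (c : ℝ) :
    ∀ᶠ x in nhds (0 : ℝ), 0 < x →
      T * (Real.exp (1 / x) - Real.exp 1) + c + Real.exp 1 ≠ 0 := by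
  have hc : Continuous fun x : ℝ =>
      T + (c + Real.exp 1 - T * Real.exp 1) * expNegInvGlue x :=
    continuous_const.add
      (continuous_const.mul (expNegInvGlue.contDiff (n := 0)).continuous)
  have h0 : T + (c + Real.exp 1 - T * Real.exp 1) * expNegInvGlue 0 ≠ 0 := by
    simpa using hT.ne'
  filter_upwards [hc.continuousAt.eventually_ne h0] with x hx hpos
  rw [add_mul_expNegInvGlue_eq T c hpos] at hx
  exact right_ne_zero_of_mul hx

/-- For `T > 0`, on `Ω_T = {(x,c) : x = 0, or 0 < x < 1 and T·φ(x)+c > 0}`, the map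
`C_T(x,c) = φ⁻¹(T·φ(x)+c)` (with `C_T(0,c)=0`) is smooth, `∂_x C_T(0,c) = 1` for all `c`,
and `C_T(x,c) = B_T(B(x,c/T))` where `B_T(x) = φ⁻¹(T·φ(x))` and `B(x,c) = φ⁻¹(φ(x)+c)`. -/
theorem stmt_7 (T : ℝ) (hT : 0 < T) :
    let φ : ℝ → ℝ := fun r => Real.exp (1 / r) - Real.exp 1
    let C : ℝ → ℝ → ℝ := fun x c => if x = 0 then 0 else 1 / Real.log (T * φ x + c + Real.exp 1)
    let B : ℝ → ℝ → ℝ := fun r c => if r = 0 then 0 else 1 / Real.log (φ r + c + Real.exp 1)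
    let BT : ℝ → ℝ := fun x => if x = 0 then 0 else 1 / Real.log (T * φ x + Real.exp 1)
    let ΩT : Set (ℝ × ℝ) := {p | p.1 = 0 ∨ (0 < p.1 ∧ p.1 < 1 ∧ 0 < T * φ p.1 + p.2)}
    ContDiffOn ℝ (⊤ : ℕ∞) (fun p : ℝ × ℝ => C p.1 p.2) ΩT ∧
    (∀ c : ℝ, derivWithin (fun x => C x c) (Ici (0:ℝ)) 0 = 1) ∧
    (∀ p ∈ ΩT, C p.1 p.2 = BT (B p.1 (p.2 / T))) := by
  intro φ C B BT ΩT
  refine ⟨?_, fun c => ?_, ?_⟩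
  · have key : ContDiffOn ℝ (⊤ : ℕ∞) (fun p : ℝ × ℝ => p.1 * glueFactor T p) ΩT := by
      rintro ⟨x, c⟩ hp
      refine (contDiffAt_fst.mul ?_).contDiffWithinAt
      rcases hp with hx | ⟨hx, -, hpos⟩
      · obtain rfl : x = 0 := hx
        exact contDiffAt_glueFactor_zero hT c
      · have hpos' : 0 < T * (Real.exp (1 / x) - Real.exp 1) + c + Real.exp 1 :=
          add_pos hpos (Real.exp_pos 1)
        refine contDiffAt_glueFactor ?_ ?_
        · rw [add_mul_expNegInvGlue_eq T c hx]
          exact mul_pos (Real.exp_pos _) hpos'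
        · rw [one_add_mul_log_eq hx hpos'.ne']
          exact (mul_pos hx (log_add_exp_one_pos hpos)).ne'
    refine key.congr ?_
    rintro ⟨x, c⟩ (hx | ⟨hx, -, hpos⟩)
    · obtain rfl : x = 0 := hx
      simp [C]
    · exact (if_neg (ne_of_gt hx)).trans
        (one_div_log_eq_mul_glueFactor hx (add_pos hpos (Real.exp_pos 1)).ne')
  · have hd : DifferentiableAt ℝ (fun x : ℝ => glueFactor T (x, c)) 0 :=
      DifferentiableAt.comp (g := glueFactor T) (f := fun x : ℝ => (x, c)) (0 : ℝ)
        ((contDiffAt_glueFactor_zero hT c).differentiableAt (by simp))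
        (differentiableAt_id.prodMk (differentiableAt_const c))
    have hG : HasDerivAt (fun x : ℝ => x * glueFactor T (x, c)) 1 0 := by
      refine ((hasDerivAt_id (0 : ℝ)).mul hd.hasDerivAt).congr_deriv ?_
      simp [glueFactor_zero]
    refine (hG.hasDerivWithinAt.congr_of_eventuallyEq (s := Ici 0) ?_ (by simp [C])).derivWithin
      (uniqueDiffOn_Ici 0 0 self_mem_Ici)
    filter_upwards [nhdsWithin_le_nhds (eventually_add_exp_one_ne_zero hT c),
      self_mem_nhdsWithin] with x hx hx0
    rcases (mem_Ici.1 hx0).eq_or_lt with rfl | hx0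
    · simp [C]
    · exact (if_neg hx0.ne').trans (one_div_log_eq_mul_glueFactor hx0 (hx hx0))
  · rintro ⟨x, c⟩ (hx | ⟨hx, -, hpos⟩)
    · obtain rfl : x = 0 := hx
      simp [C, B, BT]
    · have hx : x ≠ 0 := ne_of_gt hx
      have hy : 0 < φ x + c / T := by
        have h : φ x + c / T = (T * φ x + c) / T := by field_simp
        exact h ▸ div_pos hpos hT
      have hlog : 0 < Real.log (φ x + c / T + Real.exp 1) := log_add_exp_one_pos hy
      have hB : B x (c / T) = 1 / Real.log (φ x + c / T + Real.exp 1) := if_neg hx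
      have hφ : φ (B x (c / T)) = φ x + c / T := by
        rw [hB]
        change Real.exp (1 / (1 / Real.log (φ x + c / T + Real.exp 1))) - Real.exp 1 = _
        rw [one_div_one_div, Real.exp_log (add_pos hy (Real.exp_pos 1))]
        ring
      have hB0 : B x (c / T) ≠ 0 := by
        rw [hB]
        exact (one_div_pos.2 hlog).ne'
      have hC : C x c = 1 / Real.log (T * φ x + c + Real.exp 1) := if_neg hx
      have hBT : BT (B x (c / T)) = 1 / Real.log (T * φ (B x (c / T)) + Real.exp 1) :=
        if_neg hB0
      change C x c = BT (B x (c / T))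
      rw [hC, hBT, hφ, mul_add, mul_div_cancel₀ c hT.ne']
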